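/- Let (ℱ_t^{(1)}) and (ℱ_t^{(2)}) be filtrations on a probability space (Ω, ℱ, ℙ) such that ℱ_∞^{(1)} and ℱ_∞^{(2)} are independent. For i ∈ {1,2}, let l^{(i)} be a binary-valued process adapted to (ℱ_t^{(i)}) such that for every t ∈ ℕ, ℙ[ l^{(i)}(t+1) = 0 ∣ ℱ_t^{(i)} ] ≤ p₀^{(i)} a.s. and ℙ[ l^{(i)}(t+1) = 1 ∣ ℱ_t^{(i)} ] ≤ p₁^{(i)} a.s., with p₀^{(i)}, p₁^{(i)} ∈ [0,1]. Define l̃(t) := l^{(1)}(t) ∨ l^{(2)}(t) and the join filtration ℱ_t := σ(ℱ_t^{(1)} ∪ ℱ_t^{(2)}). Then for every t ∈ ℕ, almost surely ℙ[ l̃(t+1) = 0 ∣ ℱ_t ] ≤ p₀^{(1)} p₀^{(2)} and ℙ[ l̃(t+1) = 1 ∣ ℱ_t ] ≤ min{ p₁^{(1)} + p₀^{(1)} p₁^{(2)}, p₁^{(2)} + p₀^{(2)} p₁^{(1)}, 1 }. -/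

import Mathlib

open MeasureTheory Filter Set ProbabilityTheory

lemma aux_setIntegral {Ω : Type*} {m0 : MeasurableSpace Ω} {μ : Measure Ω}
    [IsProbabilityMeasure μ] {H1 H2 : MeasurableSpace Ω} (hH1 : H1 ≤ m0) (hH2 : H2 ≤ m0)
    (hi : Indep H1 H2 μ) {f g : Ω → ℝ} (hf : StronglyMeasurable[H1] f)
    (hg : StronglyMeasurable[H2] g) {S T : Set Ω} (hS : MeasurableSet[H1] S)
    (hT : MeasurableSet[H2] T) :
    ∫ x in S ∩ T, f x * g x ∂μ = (∫ x in S, f x ∂μ) * ∫ x in T, g x ∂μ := by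
  rw [← integral_indicator (hH1 _ hS), ← integral_indicator (hH2 _ hT),
    ← integral_indicator ((hH1 _ hS).inter (hH2 _ hT))]
  have h1 : StronglyMeasurable[H1] (S.indicator f) := hf.indicator hS
  have h2 : StronglyMeasurable[H2] (T.indicator g) := hg.indicator hT
  have hI : IndepFun (S.indicator f) (T.indicator g) μ :=
    (IndepFun_iff_Indep _ _ _).2
      (indep_of_indep_of_le hi h1.measurable.comap_le h2.measurable.comap_le)
  rw [← hI.integral_fun_mul_eq_mul_integral (h1.mono hH1).aestronglyMeasurable
    (h2.mono hH2).aestronglyMeasurable]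
  congr 1
  ext x
  by_cases hx : x ∈ S <;> by_cases hy : x ∈ T <;> simp [hx, hy]

lemma aux_sup {Ω : Type*} (G1 G2 : MeasurableSpace Ω) :
    G1 ⊔ G2 = MeasurableSpace.generateFrom
      (image2 (· ∩ ·) {s | MeasurableSet[G1] s} {s | MeasurableSet[G2] s}) := by
  apply le_antisymm
  · refine sup_le ?_ ?_
    · intro s hs
      exact MeasurableSpace.measurableSet_generateFrom
        ⟨s, hs, univ, @MeasurableSet.univ _ G2, by simp⟩
    · intro s hs
      exact MeasurableSpace.measurableSet_generateFrom
        ⟨univ, @MeasurableSet.univ _ G1, s, hs, by simp⟩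
  · refine MeasurableSpace.generateFrom_le ?_
    rintro _ ⟨s, hs, t, ht, rfl⟩
    exact @MeasurableSet.inter _ (G1 ⊔ G2) _ _ ((le_sup_left : G1 ≤ G1 ⊔ G2) _ hs)
      ((le_sup_right : G2 ≤ G1 ⊔ G2) _ ht)

lemma aux_pi {Ω : Type*} (G1 G2 : MeasurableSpace Ω) :
    IsPiSystem (image2 (· ∩ ·) {s | MeasurableSet[G1] s} {s : Set Ω | MeasurableSet[G2] s}) := by
  rintro _ ⟨s, hs, t, ht, rfl⟩ _ ⟨s', hs', t', ht', rfl⟩ _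
  exact ⟨s ∩ s', @MeasurableSet.inter _ G1 _ _ hs hs', t ∩ t', @MeasurableSet.inter _ G2 _ _ ht ht',
    by simp only; rw [inter_inter_inter_comm]⟩

lemma aux_indepFun {Ω : Type*} {m0 : MeasurableSpace Ω} {μ : Measure Ω}
    {H1 H2 : MeasurableSpace Ω}
    (hi : Indep H1 H2 μ) {f g : Ω → ℝ} (hf : StronglyMeasurable[H1] f)
    (hg : StronglyMeasurable[H2] g) : IndepFun f g μ :=
  (IndepFun_iff_Indep _ _ _).2
      (indep_of_indep_of_le hi hf.measurable.comap_le hg.measurable.comap_le)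

lemma aux_condExp {Ω : Type*} {m0 : MeasurableSpace Ω} {μ : Measure Ω}
    [IsProbabilityMeasure μ] {G1 G2 H1 H2 : MeasurableSpace Ω} (hH1 : H1 ≤ m0) (hH2 : H2 ≤ m0)
    (hG1 : G1 ≤ H1) (hG2 : G2 ≤ H2)
    (hi : Indep H1 H2 μ) {f g : Ω → ℝ} (hf : StronglyMeasurable[H1] f)
    (hg : StronglyMeasurable[H2] g) (hfi : Integrable f μ) (hgi : Integrable g μ) :
    (fun x => (μ[f | G1]) x * (μ[g | G2]) x) =ᵐ[μ] μ[fun x => f x * g x | G1 ⊔ G2] := by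
  have hG : G1 ⊔ G2 ≤ m0 := sup_le (hG1.trans hH1) (hG2.trans hH2)
  have hu : StronglyMeasurable[G1] (μ[f | G1]) := stronglyMeasurable_condExp
  have hv : StronglyMeasurable[G2] (μ[g | G2]) := stronglyMeasurable_condExp
  have hfg : Integrable (fun x => f x * g x) μ := (aux_indepFun hi hf hg).integrable_mul hfi hgi
  have huv : Integrable (fun x => (μ[f | G1]) x * (μ[g | G2]) x) μ :=
    (aux_indepFun hi (hu.mono hG1) (hv.mono hG2)).integrable_mul integrable_condExp
      integrable_condExp
  refine ae_eq_condExp_of_forall_setIntegral_eq hG hfg (fun s _ _ => huv.integrableOn) ?_ ?_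
  · intro s hs _
    induction s, hs using MeasurableSpace.induction_on_inter (aux_sup G1 G2) (aux_pi G1 G2) with
    | empty => simp
    | basic t ht =>
      obtain ⟨S, hS, T, hT, rfl⟩ := ht
      simp only
      rw [aux_setIntegral hH1 hH2 hi hf hg (hG1 _ hS) (hG2 _ hT),
        aux_setIntegral hH1 hH2 hi (hu.mono hG1) (hv.mono hG2) (hG1 _ hS) (hG2 _ hT),
        setIntegral_condExp (hG1.trans hH1) hfi hS, setIntegral_condExp (hG2.trans hH2) hgi hT]
    | compl t ht ih =>
      have e1 := integral_add_compl (hG _ ht) huv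
      have e2 := integral_add_compl (hG _ ht) hfg
      have e3 : ∫ x, (μ[f | G1]) x * (μ[g | G2]) x ∂μ = ∫ x, f x * g x ∂μ := by
        have a1 := aux_setIntegral hH1 hH2 hi hf hg (@MeasurableSet.univ _ H1)
          (@MeasurableSet.univ _ H2)
        have a2 := aux_setIntegral hH1 hH2 hi (hu.mono hG1) (hv.mono hG2)
          (@MeasurableSet.univ _ H1) (@MeasurableSet.univ _ H2)
        simp only [inter_self, Measure.restrict_univ] at a1 a2
        rw [a1, a2, integral_condExp (hG1.trans hH1), integral_condExp (hG2.trans hH2)]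
      have := ih (measure_lt_top _ _)
      linarith
    | iUnion F hd hF ih =>
      rw [integral_iUnion (fun i => hG _ (hF i)) hd huv.integrableOn,
        integral_iUnion (fun i => hG _ (hF i)) hd hfg.integrableOn]
      exact tsum_congr fun i => ih i (measure_lt_top _ _)
  · exact ((hu.mono le_sup_left).mul (hv.mono le_sup_right)).aestronglyMeasurable

lemma aux_inter {Ω : Type*} {m0 : MeasurableSpace Ω} {μ : Measure Ω}
    [IsProbabilityMeasure μ] {G1 G2 H1 H2 : MeasurableSpace Ω} (hH1 : H1 ≤ m0) (hH2 : H2 ≤ m0)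
    (hG1 : G1 ≤ H1) (hG2 : G2 ≤ H2)
    (hi : Indep H1 H2 μ) {A B : Set Ω} (hA : MeasurableSet[H1] A) (hB : MeasurableSet[H2] B)
    {a b : ℝ} (ha0 : 0 ≤ a)
    (ha : ∀ᵐ ω ∂μ, (μ[A.indicator (fun _ => (1 : ℝ)) | G1]) ω ≤ a)
    (hb : ∀ᵐ ω ∂μ, (μ[B.indicator (fun _ => (1 : ℝ)) | G2]) ω ≤ b) :
    ∀ᵐ ω ∂μ, (μ[(A ∩ B).indicator (fun _ => (1 : ℝ)) | G1 ⊔ G2]) ω ≤ a * b := by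
  have key := aux_condExp (μ := μ) hH1 hH2 hG1 hG2 hi
    (f := A.indicator (fun _ => (1 : ℝ))) (g := B.indicator (fun _ => (1 : ℝ)))
    (stronglyMeasurable_const.indicator hA) (stronglyMeasurable_const.indicator hB)
    ((integrable_const _).indicator (hH1 _ hA)) ((integrable_const _).indicator (hH2 _ hB))
  have e : (fun x => A.indicator (fun _ => (1 : ℝ)) x * B.indicator (fun _ => (1 : ℝ)) x)
      = (A ∩ B).indicator (fun _ => (1 : ℝ)) := by
    ext x
    by_cases hx : x ∈ A <;> by_cases hy : x ∈ B <;> simp [hx, hy]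
  rw [e] at key
  have hnn : 0 ≤ᵐ[μ] μ[B.indicator (fun _ => (1 : ℝ)) | G2] :=
    condExp_nonneg (Eventually.of_forall fun x => indicator_nonneg (fun _ _ => zero_le_one) x)
  filter_upwards [key, ha, hb, hnn] with ω h1 h2 h3 h4
  rw [← h1]
  exact mul_le_mul h2 h3 h4 ha0

lemma aux_union {Ω : Type*} {m0 : MeasurableSpace Ω} {μ : Measure Ω}
    [IsProbabilityMeasure μ] {G1 G2 H1 H2 : MeasurableSpace Ω} (hH1 : H1 ≤ m0) (hH2 : H2 ≤ m0)
    (hG1 : G1 ≤ H1) (hG2 : G2 ≤ H2)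
    (hi : Indep H1 H2 μ) {A A' B C : Set Ω} (hA : MeasurableSet[H1] A)
    (hA' : MeasurableSet[H1] A') (hB : MeasurableSet[H2] B) (hC : MeasurableSet[m0] C)
    (hsub : C ⊆ A' ∪ (A ∩ B))
    {a a' b : ℝ} (ha0 : 0 ≤ a) (ha0' : 0 ≤ a')
    (ha : ∀ᵐ ω ∂μ, (μ[A.indicator (fun _ => (1 : ℝ)) | G1]) ω ≤ a)
    (ha' : ∀ᵐ ω ∂μ, (μ[A'.indicator (fun _ => (1 : ℝ)) | G1]) ω ≤ a')
    (hb : ∀ᵐ ω ∂μ, (μ[B.indicator (fun _ => (1 : ℝ)) | G2]) ω ≤ b) :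
    ∀ᵐ ω ∂μ, (μ[C.indicator (fun _ => (1 : ℝ)) | G1 ⊔ G2]) ω ≤ a' + a * b := by
  have h1 := aux_inter hH1 hH2 hG1 hG2 hi hA hB ha0 ha hb
  have h2 := aux_inter (b := 1) hH1 hH2 hG1 hG2 hi hA' (@MeasurableSet.univ _ H2) ha0' ha' (by
    rw [indicator_univ, condExp_const (hG2.trans hH2)]
    simp)
  rw [inter_univ] at h2
  have i1 : Integrable (A'.indicator (fun _ => (1 : ℝ))) μ :=
    (integrable_const _).indicator (hH1 _ hA')
  have i2 : Integrable ((A ∩ B).indicator (fun _ => (1 : ℝ))) μ :=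
    (integrable_const _).indicator ((hH1 _ hA).inter (hH2 _ hB))
  have i3 : Integrable (C.indicator (fun _ => (1 : ℝ))) μ := (integrable_const _).indicator hC
  have hm := condExp_mono (m := G1 ⊔ G2) i3 (i1.add i2) (Eventually.of_forall fun x => by
    by_cases hc : x ∈ C
    · rcases hsub hc with h | h
      · have : 0 ≤ (A ∩ B).indicator (fun _ => (1 : ℝ)) x :=
          indicator_nonneg (fun _ _ => zero_le_one) x
        simpa [hc, h] using this
      · have : 0 ≤ A'.indicator (fun _ => (1 : ℝ)) x :=
          indicator_nonneg (fun _ _ => zero_le_one) x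
        simp only [Pi.add_apply, indicator_of_mem hc, indicator_of_mem h]
        linarith
    · rw [indicator_of_notMem hc]
      exact add_nonneg (indicator_nonneg (fun _ _ => zero_le_one) x)
        (indicator_nonneg (fun _ _ => zero_le_one) x))
  filter_upwards [h1, h2, hm, condExp_add i1 i2 (G1 ⊔ G2)] with ω k1 k2 k3 k4
  rw [k4, Pi.add_apply] at k3
  linarith

/-- Theorem 3.2 (filtration form): if `l⁽¹⁾` and `l⁽²⁾` are binary processes
adapted to independent filtrations and satisfying the `Γ`-type conditional
bounds with parameters `(p₀⁽ⁱ⁾, p₁⁽ⁱ⁾)`, then `l̃(t) = l⁽¹⁾(t) ∨ l⁽²⁾(t)`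
satisfies the `Γ`-type bounds with parameters
`p̃₀ = p₀⁽¹⁾p₀⁽²⁾` and `p̃₁ = min{p₁⁽¹⁾+p₀⁽¹⁾p₁⁽²⁾, p₁⁽²⁾+p₀⁽²⁾p₁⁽¹⁾, 1}`
with respect to the join filtration. -/
theorem or_hidden_markov {Ω : Type*} {m0 : MeasurableSpace Ω} {μ : Measure Ω}
    [IsProbabilityMeasure μ] (ℱ1 ℱ2 : Filtration ℕ m0)
    (hindep : Indep (⨆ t, (ℱ1 t : MeasurableSpace Ω))
      (⨆ t, (ℱ2 t : MeasurableSpace Ω)) μ)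
    (l1 l2 : ℕ → Ω → ℕ)
    (hbin1 : ∀ t ω, l1 t ω ≤ 1) (hbin2 : ∀ t ω, l2 t ω ≤ 1)
    (hadp1 : ∀ t, Measurable[ℱ1 t] (l1 t)) (hadp2 : ∀ t, Measurable[ℱ2 t] (l2 t))
    {p01 p11 p02 p12 : ℝ}
    (hp01 : p01 ∈ Set.Icc (0 : ℝ) 1) (hp11 : p11 ∈ Set.Icc (0 : ℝ) 1)
    (hp02 : p02 ∈ Set.Icc (0 : ℝ) 1) (hp12 : p12 ∈ Set.Icc (0 : ℝ) 1)
    (hcond10 : ∀ t, ∀ᵐ ω ∂μ,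
      (μ[Set.indicator {ω' | l1 (t + 1) ω' = 0} (fun _ => (1 : ℝ)) | ℱ1 t]) ω ≤ p01)
    (hcond11 : ∀ t, ∀ᵐ ω ∂μ,
      (μ[Set.indicator {ω' | l1 (t + 1) ω' = 1} (fun _ => (1 : ℝ)) | ℱ1 t]) ω ≤ p11)
    (hcond20 : ∀ t, ∀ᵐ ω ∂μ,
      (μ[Set.indicator {ω' | l2 (t + 1) ω' = 0} (fun _ => (1 : ℝ)) | ℱ2 t]) ω ≤ p02)
    (hcond21 : ∀ t, ∀ᵐ ω ∂μ,
      (μ[Set.indicator {ω' | l2 (t + 1) ω' = 1} (fun _ => (1 : ℝ)) | ℱ2 t]) ω ≤ p12) :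
    ∀ t : ℕ,
      (∀ᵐ ω ∂μ,
        (μ[Set.indicator {ω' | max (l1 (t + 1) ω') (l2 (t + 1) ω') = 0}
            (fun _ => (1 : ℝ)) | (ℱ1 t : MeasurableSpace Ω) ⊔ (ℱ2 t : MeasurableSpace Ω)]) ω
          ≤ p01 * p02) ∧
      (∀ᵐ ω ∂μ,
        (μ[Set.indicator {ω' | max (l1 (t + 1) ω') (l2 (t + 1) ω') = 1}
            (fun _ => (1 : ℝ)) | (ℱ1 t : MeasurableSpace Ω) ⊔ (ℱ2 t : MeasurableSpace Ω)]) ω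
          ≤ min (min (p11 + p01 * p12) (p12 + p02 * p11)) 1) := by
  intro t
  have hH1 : (⨆ t, (ℱ1 t : MeasurableSpace Ω)) ≤ m0 := iSup_le fun i => ℱ1.le i
  have hH2 : (⨆ t, (ℱ2 t : MeasurableSpace Ω)) ≤ m0 := iSup_le fun i => ℱ2.le i
  have hG1 : ∀ s, (ℱ1 s : MeasurableSpace Ω) ≤ ⨆ t, (ℱ1 t : MeasurableSpace Ω) :=
    fun s => le_iSup (fun t => (ℱ1 t : MeasurableSpace Ω)) s
  have hG2 : ∀ s, (ℱ2 s : MeasurableSpace Ω) ≤ ⨆ t, (ℱ2 t : MeasurableSpace Ω) :=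
    fun s => le_iSup (fun t => (ℱ2 t : MeasurableSpace Ω)) s
  have hm1 : ∀ k : ℕ, MeasurableSet[⨆ t, (ℱ1 t : MeasurableSpace Ω)] {ω' | l1 (t + 1) ω' = k} :=
    fun k => hG1 (t + 1) _ (hadp1 (t + 1) (measurableSet_singleton k))
  have hm2 : ∀ k : ℕ, MeasurableSet[⨆ t, (ℱ2 t : MeasurableSpace Ω)] {ω' | l2 (t + 1) ω' = k} :=
    fun k => hG2 (t + 1) _ (hadp2 (t + 1) (measurableSet_singleton k))
  constructor
  · have e : {ω' | max (l1 (t + 1) ω') (l2 (t + 1) ω') = 0}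
        = {ω' | l1 (t + 1) ω' = 0} ∩ {ω' | l2 (t + 1) ω' = 0} := by
      ext x
      simp only [mem_setOf_eq, mem_inter_iff]
      omega
    rw [e]
    exact aux_inter hH1 hH2 (hG1 t) (hG2 t) hindep (hm1 0) (hm2 0) hp01.1 (hcond10 t) (hcond20 t)
  · have hC : MeasurableSet[m0] {ω' | max (l1 (t + 1) ω') (l2 (t + 1) ω') = 1} := by
      have h1 : Measurable[m0] (l1 (t + 1)) := (hadp1 (t + 1)).mono (ℱ1.le _) le_rfl
      have h2 : Measurable[m0] (l2 (t + 1)) := (hadp2 (t + 1)).mono (ℱ2.le _) le_rfl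
      exact (h1.max h2) (measurableSet_singleton 1)
    have b1 := aux_union hH1 hH2 (hG1 t) (hG2 t) hindep (hm1 0) (hm1 1) (hm2 1) hC
      (by
        intro x hx
        have := hbin1 (t + 1) x
        have := hbin2 (t + 1) x
        simp only [mem_setOf_eq, mem_inter_iff, mem_union] at hx ⊢
        omega) hp01.1 hp11.1 (hcond10 t) (hcond11 t) (hcond21 t)
    have b2 := aux_union hH2 hH1 (hG2 t) (hG1 t) hindep.symm (hm2 0) (hm2 1) (hm1 1) hC
      (by
        intro x hx
        have := hbin1 (t + 1) x
        have := hbin2 (t + 1) x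
        simp only [mem_setOf_eq, mem_inter_iff, mem_union] at hx ⊢
        omega) hp02.1 hp12.1 (hcond20 t) (hcond21 t) (hcond11 t)
    rw [sup_comm] at b2
    have b3 := condExp_mono (μ := μ) (m := (ℱ1 t : MeasurableSpace Ω) ⊔ (ℱ2 t : MeasurableSpace Ω))
      ((integrable_const (1 : ℝ)).indicator hC) (integrable_const (1 : ℝ))
      (Eventually.of_forall fun x => indicator_le_self' (fun _ _ => zero_le_one) x)
    rw [condExp_const (sup_le (ℱ1.le t) (ℱ2.le t))] at b3
    filter_upwards [b1, b2, b3] with ω k1 k2 k3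
    exact le_min (le_min k1 k2) k3
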